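/- There exist absolute constants ξ > 0 and β₀ such that the following holds. Let 0 < ε ≤ 1, c = √(2π)·ε/20, β ≥ β₀, λ = max{c^{-2}, β²}, and let n, d satisfy d ≥ λ·n^{1/2} and q = d/n ≤ 1. Let m be an integer with (n − 2c√n)/2 − 2 ≤ m ≤ (n − 2c√n)/2, let X and Y be independent Binomial(m, q) random variables, and let μ = m''·q for some integer m'' with 2c√n − 2 ≤ m'' ≤ 2c√n + 2. Then for all sufficiently large n and every integer ℓ with μ/2 − 2 < ℓ ≤ 2μ − 2, P(X + ℓ ≥ Y) > 1/2 + ξ·ℓ/√d. -/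

import Mathlib

open MeasureTheory ProbabilityTheory
open scoped ENNReal

/-- The probability that a `Binomial(m, q)` random variable equals `k`. -/
noncomputable def binomProb (m : ℕ) (q : ℝ) (k : ℕ) : ℝ :=
  (m.choose k : ℝ) * q ^ k * (1 - q) ^ (m - k)

lemma binomProb_nonneg {q : ℝ} (h0 : 0 ≤ q) (h1 : q ≤ 1) (m k : ℕ) : 0 ≤ binomProb m q k := by
  have : 0 ≤ 1 - q := by linarith
  unfold binomProb
  positivity

/-- Pascal's rule for binomial probabilities. -/
lemma binomProb_succ_succ (m : ℕ) (q : ℝ) (k : ℕ) :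
    binomProb (m + 1) q (k + 1) = q * binomProb m q k + (1 - q) * binomProb m q (k + 1) := by
  unfold binomProb
  rw [Nat.choose_succ_succ, Nat.add_sub_add_right]
  rcases lt_or_ge k m with h | h
  · obtain ⟨r, rfl⟩ : ∃ r, m = k + 1 + r := ⟨m - (k + 1), by omega⟩
    have e₁ : k + 1 + r - k = r + 1 := by omega
    have e₂ : k + 1 + r - (k + 1) = r := by omega
    rw [e₁, e₂]
    push_cast
    ring
  · rw [Nat.choose_eq_zero_of_lt (by omega : m < k + 1)]
    push_cast
    ring

/-- The expectation of `f` under the `Binomial(m, q)` distribution. -/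
noncomputable def binomExp (m : ℕ) (q : ℝ) (f : ℕ → ℝ) : ℝ :=
  ∑ k ∈ Finset.range (m + 1), binomProb m q k * f k

lemma binomExp_succ (m : ℕ) (q : ℝ) (f : ℕ → ℝ) :
    binomExp (m + 1) q f = binomExp m q (fun k => q * f (k + 1) + (1 - q) * f k) := by
  have hlast : binomProb m q (m + 1) = 0 := by simp [binomProb]
  have hzero : binomProb (m + 1) q 0 = (1 - q) * binomProb m q 0 := by
    simp [binomProb, pow_succ, mul_comm]
  have hshift : ∑ k ∈ Finset.range (m + 1), binomProb m q (k + 1) * f (k + 1)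
      + binomProb m q 0 * f 0 = ∑ k ∈ Finset.range (m + 1), binomProb m q k * f k := by
    rw [← Finset.sum_range_succ' (fun k => binomProb m q k * f k),
      Finset.sum_range_succ, hlast, zero_mul, add_zero]
  unfold binomExp
  rw [Finset.sum_range_succ', hzero]
  have hl : ∀ k, binomProb (m + 1) q (k + 1) * f (k + 1) =
      q * (binomProb m q k * f (k + 1)) + (1 - q) * (binomProb m q (k + 1) * f (k + 1)) := by
    intro k
    rw [binomProb_succ_succ]
    ring
  have hr : ∀ k, binomProb m q k * (q * f (k + 1) + (1 - q) * f k) =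
      q * (binomProb m q k * f (k + 1)) + (1 - q) * (binomProb m q k * f k) := by
    intro k
    ring
  simp_rw [hl, hr, Finset.sum_add_distrib, ← Finset.mul_sum]
  rw [← hshift]
  ring

/-- The expectation of `f (X - Y)` for independent `Binomial(m, q)` variables `X` and `Y`. -/
noncomputable def diffExp (m : ℕ) (q : ℝ) (f : ℤ → ℝ) : ℝ :=
  binomExp m q fun i => binomExp m q fun j => f ((i : ℤ) - j)

lemma binomExp_add (m : ℕ) (q : ℝ) (f g : ℕ → ℝ) :
    binomExp m q (fun k => f k + g k) = binomExp m q f + binomExp m q g := by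
  simp [binomExp, mul_add, Finset.sum_add_distrib]

lemma binomExp_const_mul (m : ℕ) (q a : ℝ) (f : ℕ → ℝ) :
    binomExp m q (fun k => a * f k) = a * binomExp m q f := by
  simp [binomExp, Finset.mul_sum, mul_left_comm]

lemma diffExp_add (m : ℕ) (q : ℝ) (f g : ℤ → ℝ) :
    diffExp m q (fun z => f z + g z) = diffExp m q f + diffExp m q g := by
  simp only [diffExp, binomExp_add]

lemma diffExp_const_mul (m : ℕ) (q a : ℝ) (f : ℤ → ℝ) :
    diffExp m q (fun z => a * f z) = a * diffExp m q f := by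
  simp only [diffExp, binomExp_const_mul]

lemma diffExp_mono {q : ℝ} (h0 : 0 ≤ q) (h1 : q ≤ 1) (m : ℕ) {f g : ℤ → ℝ}
    (h : ∀ z, f z ≤ g z) : diffExp m q f ≤ diffExp m q g := by
  unfold diffExp binomExp
  have hb := binomProb_nonneg h0 h1 m
  exact Finset.sum_le_sum fun i _ => mul_le_mul_of_nonneg_left
    (Finset.sum_le_sum fun j _ => mul_le_mul_of_nonneg_left (h _) (hb j)) (hb i)

lemma diffExp_neg (m : ℕ) (q : ℝ) (f : ℤ → ℝ) :
    diffExp m q (fun z => f (-z)) = diffExp m q f := by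
  simp only [diffExp, binomExp, Finset.mul_sum, neg_sub]
  rw [Finset.sum_comm]
  simp only [mul_left_comm]

lemma diffExp_zero (q : ℝ) (f : ℤ → ℝ) : diffExp 0 q f = f 0 := by
  simp [diffExp, binomExp, binomProb]

/-- The difference of two independent binomial variables is a lazy random walk. -/
lemma diffExp_succ (m : ℕ) (q : ℝ) (f : ℤ → ℝ) :
    diffExp (m + 1) q f = diffExp m q (fun z => (1 - 2 * (q * (1 - q))) * f z
      + (q * (1 - q) * f (z + 1) + q * (1 - q) * f (z - 1))) := by
  unfold diffExp
  rw [binomExp_succ]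
  simp_rw [binomExp_succ, ← binomExp_const_mul, ← binomExp_add]
  congr 1
  funext i
  congr 1
  funext j
  have e₁ : ((i + 1 : ℕ) : ℤ) - (j + 1 : ℕ) = i - j := by push_cast; ring
  have e₂ : ((i + 1 : ℕ) : ℤ) - j = i - j + 1 := by push_cast; ring
  have e₃ : (i : ℤ) - (j + 1 : ℕ) = i - j - 1 := by push_cast; ring
  rw [e₁, e₂, e₃]
  ring

lemma diffExp_one (m : ℕ) (q : ℝ) : diffExp m q (fun _ => 1) = 1 := by
  induction m with
  | zero => exact diffExp_zero q _
  | succ m ih =>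
    rw [diffExp_succ]
    convert ih using 2
    funext _
    ring

lemma diffExp_sq (m : ℕ) (q : ℝ) :
    diffExp m q (fun z => (z : ℝ) ^ 2) = 2 * m * (q * (1 - q)) := by
  induction m with
  | zero => simp [diffExp_zero]
  | succ m ih =>
    have h : (fun z : ℤ => (1 - 2 * (q * (1 - q))) * (z : ℝ) ^ 2
        + (q * (1 - q) * ((z + 1 : ℤ) : ℝ) ^ 2 + q * (1 - q) * ((z - 1 : ℤ) : ℝ) ^ 2))
        = fun z : ℤ => (z : ℝ) ^ 2 + 2 * (q * (1 - q)) * 1 := by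
      funext z
      push_cast
      ring
    rw [diffExp_succ, h, diffExp_add, diffExp_const_mul, diffExp_one, ih]
    push_cast
    ring

/-- The probability that the difference of two independent `Binomial(m, q)` variables is `k`. -/
noncomputable def diffProb (m : ℕ) (q : ℝ) (k : ℤ) : ℝ :=
  diffExp m q fun z => if z = k then 1 else 0

lemma diffProb_succ (m : ℕ) (q : ℝ) (k : ℤ) :
    diffProb (m + 1) q k = (1 - 2 * (q * (1 - q))) * diffProb m q k
      + (q * (1 - q) * diffProb m q (k - 1) + q * (1 - q) * diffProb m q (k + 1)) := by
  unfold diffProb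
  rw [diffExp_succ]
  simp_rw [← eq_sub_iff_add_eq, sub_eq_iff_eq_add]
  rw [diffExp_add, diffExp_add, diffExp_const_mul, diffExp_const_mul, diffExp_const_mul]

lemma diffProb_neg (m : ℕ) (q : ℝ) (k : ℤ) : diffProb m q (-k) = diffProb m q k := by
  unfold diffProb
  rw [← diffExp_neg]
  simp only [neg_inj]

/-- The difference of two independent, identically distributed binomial variables is unimodal. -/
lemma diffProb_antitone {q : ℝ} (h0 : 0 ≤ q) (h1 : q ≤ 1) (m k : ℕ) :
    diffProb m q (k + 1) ≤ diffProb m q k := by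
  have hp0 : 0 ≤ q * (1 - q) := mul_nonneg h0 (by linarith)
  have hp1 : q * (1 - q) ≤ 1 / 4 := by nlinarith [sq_nonneg (q - 1 / 2)]
  induction m generalizing k with
  | zero =>
    unfold diffProb
    rw [diffExp_zero, diffExp_zero, if_neg (by omega)]
    split_ifs <;> norm_num
  | succ m ih =>
    rw [diffProb_succ, diffProb_succ]
    have i₁ := ih k
    have i₂ := ih (k + 1)
    push_cast at i₂
    rw [add_sub_cancel_right]
    rcases k with _ | k
    · have hs := diffProb_neg m q 1
      simp only [Nat.cast_zero, zero_add, zero_sub] at i₁ i₂ ⊢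
      rw [hs]
      nlinarith
    · have i₃ := ih k
      push_cast at i₁ i₂ ⊢
      rw [add_sub_cancel_right]
      nlinarith

/-- The probability that two independent `Binomial(m, q)` variables differ by at most `L`. -/
noncomputable def diffBall (m : ℕ) (q : ℝ) (L : ℕ) : ℝ :=
  diffExp m q fun z => if |z| ≤ L then 1 else 0

lemma diffBall_zero (m : ℕ) (q : ℝ) : diffBall m q 0 = diffProb m q 0 := by
  simp [diffBall, diffProb]

lemma diffBall_succ (m : ℕ) (q : ℝ) (L : ℕ) :
    diffBall m q (L + 1) = diffBall m q L + 2 * diffProb m q (L + 1) := by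
  have h : (fun z : ℤ => if |z| ≤ ((L + 1 : ℕ) : ℤ) then (1 : ℝ) else 0) =
      fun z : ℤ => (if |z| ≤ (L : ℤ) then (1 : ℝ) else 0) +
        ((if z = (L : ℤ) + 1 then 1 else 0) + if z = -((L : ℤ) + 1) then 1 else 0) := by
    funext z
    simp only [abs_le]
    split_ifs <;> first | omega | norm_num
  have hs : diffProb m q (-((L : ℤ) + 1)) = diffProb m q (L + 1) := diffProb_neg m q _
  unfold diffBall
  rw [h, diffExp_add, diffExp_add]
  unfold diffProb at hs ⊢
  rw [hs]
  ring

lemma mul_diffProb_le_diffBall {q : ℝ} (h0 : 0 ≤ q) (h1 : q ≤ 1) (m L : ℕ) :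
    (2 * L + 1) * diffProb m q L ≤ diffBall m q L := by
  induction L with
  | zero => simp [diffBall_zero]
  | succ L ih =>
    rw [diffBall_succ]
    have := diffProb_antitone h0 h1 m L
    push_cast
    nlinarith [(Nat.cast_nonneg L : (0 : ℝ) ≤ L)]

lemma mul_diffBall_le {q : ℝ} (h0 : 0 ≤ q) (h1 : q ≤ 1) (m : ℕ) {k L : ℕ} (h : k ≤ L) :
    (2 * k + 1) * diffBall m q L ≤ (2 * L + 1) * diffBall m q k := by
  induction L, h using Nat.le_induction with
  | base => exact le_rfl
  | succ L _ ih =>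
    have hL := mul_diffProb_le_diffBall h0 h1 m L
    have ha := diffProb_antitone h0 h1 m L
    have hL0 : (0 : ℝ) < 2 * L + 1 := by positivity
    have hk0 : (0 : ℝ) ≤ 2 * k + 1 := by positivity
    have hstep : (2 * L + 1) * diffBall m q (L + 1) ≤ (2 * L + 3) * diffBall m q L := by
      rw [diffBall_succ]
      nlinarith
    have := mul_le_mul_of_nonneg_left hstep hk0
    have := mul_le_mul_of_nonneg_left ih (by positivity : (0 : ℝ) ≤ 2 * L + 3)
    push_cast
    refine le_of_mul_le_mul_left ?_ hL0
    linarith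

/-- Chebyshev's inequality for the difference of two independent binomial variables. -/
lemma three_quarters_le_diffBall {q d : ℝ} (h0 : 0 ≤ q) (h1 : q ≤ 1) (hd : 0 < d) {m L : ℕ}
    (hm : 2 * m * q ≤ d) (hL : 2 * √d ≤ L) : 3 / 4 ≤ diffBall m q L := by
  have hle : diffExp m q (fun _ => 1) ≤ diffExp m q (fun z =>
      (if |z| ≤ (L : ℤ) then (1 : ℝ) else 0) + (4 * d)⁻¹ * (z : ℝ) ^ 2) := by
    refine diffExp_mono h0 h1 m fun z => ?_
    split_ifs with hz
    · have : 0 ≤ (4 * d)⁻¹ * (z : ℝ) ^ 2 := by positivity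
      linarith
    · have hz' : (L : ℝ) < |(z : ℝ)| := by exact_mod_cast not_le.mp hz
      have hsq : (2 * √d) ^ 2 ≤ |(z : ℝ)| ^ 2 :=
        pow_le_pow_left₀ (by positivity) (hL.trans hz'.le) 2
      rw [sq_abs, mul_pow, Real.sq_sqrt hd.le] at hsq
      rw [zero_add, inv_mul_eq_div, le_div_iff₀ (by positivity)]
      linarith
  rw [diffExp_add, diffExp_const_mul, diffExp_one, diffExp_sq] at hle
  have hvar : (4 * d)⁻¹ * (2 * m * (q * (1 - q))) ≤ 1 / 4 := by
    rw [inv_mul_eq_div, div_le_iff₀ (by positivity)]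
    nlinarith [mul_nonneg (mul_nonneg (Nat.cast_nonneg m : (0 : ℝ) ≤ m) h0) h0]
  unfold diffBall
  linarith

lemma diffExp_neg_le (m : ℕ) (q : ℝ) (k : ℕ) :
    diffExp m q (fun z => if -(k : ℤ) ≤ z then 1 else 0) = 1 / 2 + diffBall m q k / 2 := by
  have hs := diffExp_neg m q (fun z => if -(k : ℤ) ≤ z then 1 else 0)
  have hadd := diffExp_add m q (fun z => if -(k : ℤ) ≤ z then 1 else 0)
    (fun z => if -(k : ℤ) ≤ -z then 1 else 0)
  have h : (fun z : ℤ => (if -(k : ℤ) ≤ z then (1 : ℝ) else 0) + if -(k : ℤ) ≤ -z then 1 else 0)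
      = fun z : ℤ => 1 + if |z| ≤ (k : ℤ) then (1 : ℝ) else 0 := by
    funext z
    simp only [abs_le]
    split_ifs <;> first | omega | norm_num
  rw [h, diffExp_add, diffExp_one, hs] at hadd
  unfold diffBall
  linarith

lemma diffExp_le_measureReal {Ω : Type*} [MeasurableSpace Ω] (μ : Measure Ω)
    [IsProbabilityMeasure μ] {X Y : Ω → ℕ} (hX : Measurable X) (hY : Measurable Y) {m : ℕ} {q : ℝ}
    (h0 : 0 ≤ q) (h1 : q ≤ 1)
    (hXq : ∀ k : ℕ, μ {ω | X ω = k} = ENNReal.ofReal (binomProb m q k))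
    (hYq : ∀ k : ℕ, μ {ω | Y ω = k} = ENNReal.ofReal (binomProb m q k))
    (hXY : IndepFun X Y μ) (P : ℤ → Prop) [DecidablePred P] :
    diffExp m q (fun z => if P z then 1 else 0) ≤ μ.real {ω | P ((X ω : ℤ) - Y ω)} := by
  have hpair : ∀ i j, μ.real (X ⁻¹' {i} ∩ Y ⁻¹' {j}) = binomProb m q i * binomProb m q j := by
    intro i j
    have hi : μ (X ⁻¹' {i}) = _ := hXq i
    have hj : μ (Y ⁻¹' {j}) = _ := hYq j
    rw [measureReal_def, hXY.measure_inter_preimage_eq_mul _ _ (measurableSet_singleton i)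
      (measurableSet_singleton j), hi, hj, ENNReal.toReal_mul,
      ENNReal.toReal_ofReal (binomProb_nonneg h0 h1 m i),
      ENNReal.toReal_ofReal (binomProb_nonneg h0 h1 m j)]
  let s := (Finset.range (m + 1) ×ˢ Finset.range (m + 1)).filter fun x => P ((x.1 : ℤ) - x.2)
  have hsum : diffExp m q (fun z => if P z then 1 else 0)
      = ∑ x ∈ s, μ.real (X ⁻¹' {x.1} ∩ Y ⁻¹' {x.2}) := by
    simp only [s, diffExp, binomExp, Finset.sum_filter, Finset.sum_product, hpair, Finset.mul_sum,
      mul_ite, mul_one, mul_zero]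
  rw [hsum, ← measureReal_biUnion_finset]
  · refine measureReal_mono ?_
    intro ω hω
    simp only [Set.mem_iUnion] at hω
    obtain ⟨⟨i, j⟩, hx, hi, hj⟩ := hω
    have hP := (Finset.mem_filter.mp hx).2
    rw [← show X ω = i from hi, ← show Y ω = j from hj] at hP
    exact hP
  · rintro ⟨i, j⟩ _ ⟨i', j'⟩ _ hne
    refine Set.disjoint_left.mpr ?_
    rintro ω ⟨hi, hj⟩ ⟨hi', hj'⟩
    exact hne (Prod.ext (hi.symm.trans hi') (hj.symm.trans hj'))
  · exact fun x _ => (hX (measurableSet_singleton _)).inter (hY (measurableSet_singleton _))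

/-- Anticoncentration: for `k ≤ 2√d`, the difference of two independent binomial variables
of variance at most `d / 2` lies within `k` of zero with probability of order `k / √d`. -/
lemma lt_diffBall {q d : ℝ} (h0 : 0 ≤ q) (h1 : q ≤ 1) (hd : 1 ≤ d) {m k : ℕ}
    (hm : 2 * m * q ≤ d) (hk : k ≤ 2 * √d) : k / (10 * √d) < diffBall m q k := by
  have hsd : 1 ≤ √d := Real.one_le_sqrt.mpr hd
  have hL := Nat.le_ceil (2 * √d)
  have hL' := Nat.ceil_lt_add_one (by positivity : 0 ≤ 2 * √d)
  have hball := three_quarters_le_diffBall h0 h1 (by linarith) hm hL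
  have hkL : k ≤ ⌈2 * √d⌉₊ := by exact_mod_cast hk.trans hL
  have hmul := mul_diffBall_le h0 h1 m hkL
  have hk0 : (0 : ℝ) ≤ k := k.cast_nonneg
  rw [div_lt_iff₀ (by positivity)]
  have hlow : (2 * (k : ℝ) + 1) * (3 / 4) ≤ (2 * ⌈2 * √d⌉₊ + 1) * diffBall m q k :=
    (mul_le_mul_of_nonneg_left hball (by positivity)).trans hmul
  have hpos : 0 < diffBall m q k :=
    pos_of_mul_pos_right (lt_of_lt_of_le (by positivity) hlow) (by positivity)
  nlinarith

/-- **Claim (boost).** There are absolute constants `ξ > 0` and `β₀` such that: for `0 < ε ≤ 1`,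
`c = √(2π)ε/20`, `β ≥ β₀`, `λ = max{c⁻², β²}`, `d ≥ λ√n`, `q = d/n ≤ 1`, any integer `m` with
`(n - 2c√n)/2 - 2 ≤ m ≤ (n - 2c√n)/2`, independent `X, Y ~ Binomial(m, q)`, and `μ = m''·q`
for an integer `m''` with `2c√n - 2 ≤ m'' ≤ 2c√n + 2`, for all sufficiently large `n` and every
integer `ℓ` with `μ/2 - 2 < ℓ ≤ 2μ - 2`, `P(X + ℓ ≥ Y) > 1/2 + ξ·ℓ/√d`. -/
theorem boost_claim :
    ∃ ξ : ℝ, 0 < ξ ∧ ∃ β₀ : ℝ, ∀ ε : ℝ, 0 < ε → ε ≤ 1 →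
      ∀ c : ℝ, c = Real.sqrt (2 * Real.pi) * ε / 20 →
      ∀ β : ℝ, β₀ ≤ β → ∀ lam : ℝ, lam = max (c ^ 2)⁻¹ (β ^ 2) →
      ∃ n₀ : ℕ, ∀ n : ℕ, n₀ ≤ n → ∀ d q : ℝ, lam * Real.sqrt n ≤ d → q = d / n → q ≤ 1 →
      ∀ m m'' : ℕ,
        ((n : ℝ) - 2 * c * Real.sqrt n) / 2 - 2 ≤ (m : ℝ) →
        (m : ℝ) ≤ ((n : ℝ) - 2 * c * Real.sqrt n) / 2 →
        2 * c * Real.sqrt n - 2 ≤ (m'' : ℝ) → (m'' : ℝ) ≤ 2 * c * Real.sqrt n + 2 →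
      ∀ (Ω : Type) (_ : MeasurableSpace Ω) (μ : Measure Ω), IsProbabilityMeasure μ →
      ∀ X Y : Ω → ℕ, Measurable X → Measurable Y →
        (∀ k : ℕ, μ {ω | X ω = k} = ENNReal.ofReal (binomProb m q k)) →
        (∀ k : ℕ, μ {ω | Y ω = k} = ENNReal.ofReal (binomProb m q k)) →
        IndepFun X Y μ →
      ∀ ℓ : ℤ, (m'' : ℝ) * q / 2 - 2 < (ℓ : ℝ) → (ℓ : ℝ) ≤ 2 * ((m'' : ℝ) * q) - 2 →
      1 / 2 + ξ * (ℓ : ℝ) / Real.sqrt d <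
        (μ {ω | (Y ω : ℤ) ≤ (X ω : ℤ) + ℓ}).toReal := by
  refine ⟨1 / 20, by norm_num, 0, ?_⟩
  rintro ε hε hε1 c hc β _ lam hlam
  have hc0 : 0 < c := by rw [hc]; positivity
  have hc1 : c ≤ 1 / 4 := by
    have : √(2 * Real.pi) ≤ 5 := by
      rw [Real.sqrt_le_left (by norm_num)]
      linarith [Real.pi_lt_four]
    rw [hc]
    nlinarith [Real.sqrt_nonneg (2 * Real.pi)]
  have hlam' : 1 ≤ lam * c ^ 2 := by
    have : (c ^ 2)⁻¹ ≤ lam := hlam ▸ le_max_left _ _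
    rwa [← div_le_iff₀ (by positivity), one_div]
  have hlam1 : 4 ≤ lam * c := by nlinarith
  have hlam0 : 4 ≤ lam := by nlinarith
  refine ⟨⌈(2 / c) ^ 2⌉₊, ?_⟩
  rintro n hn d q hd hq hq1 m m'' _ hm hm1 hm2 Ω _ μ _ X Y hX hY hXq hYq hXY ℓ hℓ1 hℓ2
  have hsn : 2 ≤ c * √n := by
    rw [mul_comm, ← div_le_iff₀ hc0]
    exact Real.le_sqrt_of_sq_le ((Nat.le_ceil _).trans (by exact_mod_cast hn))
  have hsn0 : 0 < √(n : ℝ) := by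
    by_contra h
    rw [le_antisymm (not_lt.mp h) (Real.sqrt_nonneg _)] at hsn
    linarith
  have hn0 : (0 : ℝ) < n := Real.sqrt_pos.mp hsn0
  have hnn : √(n : ℝ) * √n = n := Real.mul_self_sqrt hn0.le
  have hqn : q * n = d := by rw [hq]; field_simp
  have hn1 : 1 ≤ √(n : ℝ) := by nlinarith
  have hd4 : 4 ≤ d := by nlinarith
  have hq0 : 0 ≤ q := by rw [hq]; positivity
  have hdn : d ≤ n := hqn ▸ mul_le_of_le_one_left hn0.le hq1
  have hs2 : 2 ≤ √d := Real.le_sqrt_of_sq_le (by linarith)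
  have hdd : √d * √d = d := Real.mul_self_sqrt (by linarith)
  have hsdn : √d ≤ √n := Real.sqrt_le_sqrt hdn
  have hqs : q * √n ≤ √d := by
    refine le_of_mul_le_mul_right ?_ hsn0
    rw [mul_assoc, hnn, hqn]
    exact hdd.symm.trans_le (mul_le_mul_of_nonneg_left hsdn (Real.sqrt_nonneg d))
  have hlq : lam ≤ q * √n := by
    refine le_of_mul_le_mul_right ?_ hsn0
    rwa [mul_assoc, hnn, hqn]
  have hμ : 4 ≤ m'' * q := by
    have : c * √n * q ≤ m'' * q := mul_le_mul_of_nonneg_right (by linarith) hq0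
    have : c * lam ≤ c * (q * √n) := mul_le_mul_of_nonneg_left hlq hc0.le
    linarith
  have hμ' : m'' * q ≤ 2 * c * √d + 2 := by
    have := mul_le_mul_of_nonneg_right hm2 hq0
    have : c * (q * √n) ≤ c * √d := mul_le_mul_of_nonneg_left hqs hc0.le
    linarith
  have hℓ0 : 0 ≤ ℓ := by
    have : (0 : ℝ) < ℓ := by linarith
    exact_mod_cast this.le
  obtain ⟨k, rfl⟩ := Int.eq_ofNat_of_zero_le hℓ0
  rw [Int.cast_natCast] at hℓ1 hℓ2 ⊢
  have hk : (k : ℝ) ≤ 2 * √d := by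
    have : c * √d ≤ 1 / 4 * √d := mul_le_mul_of_nonneg_right hc1 (Real.sqrt_nonneg d)
    linarith
  have hmq : 2 * m * q ≤ d := by
    rw [← hqn, mul_comm q]
    exact mul_le_mul_of_nonneg_right (by linarith) hq0
  have hball := lt_diffBall hq0 hq1 (by linarith) hmq hk
  have hprob := diffExp_le_measureReal μ hX hY hq0 hq1 hXq hYq hXY fun z => -(k : ℤ) ≤ z
  rw [diffExp_neg_le] at hprob
  have hset : {ω | (Y ω : ℤ) ≤ (X ω : ℤ) + k} = {ω | -(k : ℤ) ≤ (X ω : ℤ) - Y ω} := by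
    ext ω
    simp only [Set.mem_ofPred_eq]
    omega
  rw [hset, ← measureReal_def]
  have heq : 1 / 20 * (k : ℝ) / √d = k / (10 * √d) / 2 := by
    field_simp
    ring
  rw [heq]
  linarith
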